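/- Let S := A_1 A_2 ⋯ A_K be the matrix product state of the multiresolution interpolative construction. For each σ_{1:K} ∈ {0,1}^K, let k be the smallest index in {1,…,K} such that σ_{1:k} ∉ 𝒮_k (k exists since 𝒮_K = ∅). If k ≤ K−1, then S(σ_{1:K}) = Σ_{α=0}^{N} f(x_{≤k} + 2^{−k} c_N^α) · P_N^α(2^k x_{>k}), where x_{≤k} = Σ_{l=1}^{k} 2^{−l}σ_l and x_{>k} = Σ_{l=k+1}^{K} 2^{−l}σ_l. If k = K, then S(σ_{1:K}) = f(Σ_{l=1}^{K} 2^{−l}σ_l). -/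

import Mathlib

noncomputable section

/-- The Chebyshev–Lobatto node `c_N^α = (cos(πα/N)+1)/2`, shifted and scaled to `[0,1]`. -/
def chebNode (N α : ℕ) : ℝ := (Real.cos (Real.pi * α / N) + 1) / 2

/-- The Lagrange cardinal polynomial `P_N^α` for the Chebyshev–Lobatto grid. -/
def chebP (N α : ℕ) (x : ℝ) : ℝ :=
  ∏ β ∈ (Finset.range (N + 1)).erase α,
    (x - chebNode N β) / (chebNode N α - chebNode N β)

/-- The real value of a bit. -/
def bitVal (b : Bool) : ℝ := if b then 1 else 0

/-- Partial products `A_1 A_2 ⋯ A_{k+1}` of the multiresolution interpolative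
construction: `mrVec f N q Sidx k σ` is the row vector (indexed by
`Fin (N+1) ⊕ Fin (q (k+1))`) obtained from the bits `σ = σ_{1:k+1}`. The index `inl β`
is the 'grid' part and `inr i` the 'dangerous-interval indicator' part. The sets of
dangerous multi-indices are `𝒮_k = {Sidx k i : i}`. -/
def mrVec (f : ℝ → ℝ) (N : ℕ) (q : ℕ → ℕ)
    (Sidx : (k : ℕ) → Fin (q k) → (Fin k → Bool)) :
    (k : ℕ) → (Fin (k + 1) → Bool) → (Fin (N + 1) ⊕ Fin (q (k + 1))) → ℝ
  | 0, σ => Sum.elim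
      (fun β : Fin (N + 1) =>
        if ∃ i, Sidx 1 i = σ then 0 else f ((bitVal (σ 0) + chebNode N β) / 2))
      (fun i : Fin (q 1) => if Sidx 1 i = σ then 1 else 0)
  | k + 1, σ => Sum.elim
      (fun β : Fin (N + 1) =>
        (∑ α : Fin (N + 1),
          mrVec f N q Sidx k (fun i => σ i.castSucc) (Sum.inl α) *
            chebP N α ((bitVal (σ (Fin.last (k + 1))) + chebNode N β) / 2)) +
        ∑ i : Fin (q (k + 1)),
          mrVec f N q Sidx k (fun j => σ j.castSucc) (Sum.inr i) *
            (if ∃ j, Sidx (k + 2) j = Fin.snoc (Sidx (k + 1) i) (σ (Fin.last (k + 1))) then 0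
             else f ((∑ l : Fin (k + 1),
                   (2 : ℝ) ^ (-(l.val + 1 : ℤ)) * bitVal (Sidx (k + 1) i l)) +
                 (2 : ℝ) ^ (-((k : ℤ) + 2)) * bitVal (σ (Fin.last (k + 1))) +
                 (2 : ℝ) ^ (-((k : ℤ) + 2)) * chebNode N β)))
      (fun j : Fin (q (k + 2)) =>
        ∑ i : Fin (q (k + 1)),
          mrVec f N q Sidx k (fun t => σ t.castSucc) (Sum.inr i) *
            (if Sidx (k + 2) j = Fin.snoc (Sidx (k + 1) i) (σ (Fin.last (k + 1))) then 1 else 0))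

/-- The full multiresolution MPS `S = A_1 A_2 ⋯ A_K` with depth `K = M + 2`:
the partial product `A_1 ⋯ A_{K-1}` is contracted with the final core `A_K`, whose
grid part is `A_R^α(σ) = P_N^α(σ/2)` and whose dangerous part is
`F_K^i(σ) = f(x_{≤K-1}^i + 2^{-K} σ)`. -/
def mrS (f : ℝ → ℝ) (N : ℕ) (q : ℕ → ℕ)
    (Sidx : (k : ℕ) → Fin (q k) → (Fin k → Bool)) (M : ℕ)
    (σ : Fin (M + 2) → Bool) : ℝ :=
  ∑ j : Fin (N + 1) ⊕ Fin (q (M + 1)),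
    mrVec f N q Sidx M (fun i => σ i.castSucc) j *
      Sum.elim
        (fun α : Fin (N + 1) => chebP N α (bitVal (σ (Fin.last (M + 1))) / 2))
        (fun i : Fin (q (M + 1)) =>
          f ((∑ l : Fin (M + 1), (2 : ℝ) ^ (-(l.val + 1 : ℤ)) * bitVal (Sidx (M + 1) i l)) +
            (2 : ℝ) ^ (-((M : ℤ) + 2)) * bitVal (σ (Fin.last (M + 1)))))
        j

open Finset in
theorem chebP_eq_eval_basis (N α : ℕ) (x : ℝ) :
    chebP N α x = (Lagrange.basis (range (N + 1)) (chebNode N) α).eval x := by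
  simp only [chebP, Lagrange.basis, Lagrange.basisDivisor, Polynomial.eval_prod,
    Polynomial.eval_mul, Polynomial.eval_C, Polynomial.eval_sub, Polynomial.eval_X]
  exact prod_congr rfl fun β _ => by rw [div_eq_inv_mul]

theorem chebNode_injOn {N : ℕ} (hN : 1 ≤ N) :
    Set.InjOn (chebNode N) (Finset.range (N + 1) : Set ℕ) := by
  have hN' : (0 : ℝ) < N := by exact_mod_cast hN
  have mem (a : ℕ) (ha : a ∈ (Finset.range (N + 1) : Set ℕ)) :
      Real.pi * a / N ∈ Set.Icc 0 Real.pi := by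
    have ha' : (a : ℝ) ≤ N := by
      simp only [Finset.coe_range, Set.mem_Iio] at ha
      exact_mod_cast Nat.lt_succ_iff.mp ha
    have := Real.pi_pos
    refine ⟨by positivity, ?_⟩
    rw [div_le_iff₀ hN']
    gcongr
  intro a ha b hb hab
  have hcos : Real.cos (Real.pi * a / N) = Real.cos (Real.pi * b / N) := by
    simp only [chebNode] at hab
    linarith
  have h := Real.injOn_cos (mem a ha) (mem b hb) hcos
  have := Real.pi_pos
  field_simp at h
  exact_mod_cast h

open Finset in
theorem chebP_chebNode {N α β : ℕ} (hN : 1 ≤ N) (hα : α ∈ range (N + 1))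
    (hβ : β ∈ range (N + 1)) : chebP N α (chebNode N β) = if α = β then 1 else 0 := by
  rw [chebP_eq_eval_basis]
  split_ifs with h
  · subst h
    exact Lagrange.eval_basis_self (chebNode_injOn hN) hα
  · exact Lagrange.eval_basis_of_ne h hβ

open Finset Polynomial in
/-- Interpolating an affine reparametrization of a cardinal polynomial is exact. -/
theorem sum_chebP_affine_mul_chebP {N α : ℕ} (hN : 1 ≤ N) (hα : α ∈ range (N + 1))
    (u v y : ℝ) :
    ∑ β ∈ range (N + 1), chebP N α (u + v * chebNode N β) * chebP N β y =
      chebP N α (u + v * y) := by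
  have hinj := chebNode_injOn hN
  set p : ℝ[X] := (Lagrange.basis (range (N + 1)) (chebNode N) α).comp (C u + C v * X) with hp
  have heval (x : ℝ) : p.eval x = chebP N α (u + v * x) := by
    simp [hp, chebP_eq_eval_basis]
  have hnat : p.natDegree ≤ N := by
    refine natDegree_comp_le.trans ?_
    have h1 : (Lagrange.basis (range (N + 1)) (chebNode N) α).natDegree = N := by
      apply natDegree_eq_of_degree_eq_some
      rw [Lagrange.degree_basis hinj hα]
      simp
    have h2 : (C u + C v * X : ℝ[X]).natDegree ≤ 1 := by compute_degree
    rw [h1]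
    nlinarith
  have hdeg : p.degree < #(range (N + 1)) := by
    rw [card_range]
    exact degree_le_natDegree.trans_lt (by exact_mod_cast Nat.lt_succ_of_le hnat)
  have h := congrArg (Polynomial.eval y) (Lagrange.eq_interpolate hinj hdeg)
  rw [Lagrange.interpolate_apply, eval_finsetSum, heval] at h
  rw [h]
  refine sum_congr rfl fun β _ => ?_
  rw [eval_mul, eval_C, heval, chebP_eq_eval_basis N β]

/-- The term `2^{-(l+1)} s_l` of the binary expansion of an infinite bit sequence. -/
def bitTerm (s : ℕ → Bool) (l : ℕ) : ℝ := (2 : ℝ) ^ (-(l + 1 : ℤ)) * bitVal (s l)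

theorem two_zpow_neg_add_one (n : ℤ) : (2 : ℝ) ^ (-(n + 1)) = (2 : ℝ) ^ (-n) / 2 := by
  rw [neg_add, zpow_add₀ two_ne_zero]
  norm_num
  ring

theorem snoc_truncation (s : ℕ → Bool) (n : ℕ) :
    (Fin.snoc (fun t : Fin n => s t) (s n) : Fin (n + 1) → Bool) =
      fun t : Fin (n + 1) => s t := by
  funext t
  refine Fin.lastCases ?_ (fun i => ?_) t
  · simp
  · simp

section Nested

variable {q : ℕ → ℕ} {Sidx : (k : ℕ) → Fin (q k) → (Fin k → Bool)}

/-- If a child index equals the truncation of `s`, then so does its parent. -/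
theorem eq_truncation_of_snoc_eq {s : ℕ → Bool} {n : ℕ} {v : Fin n → Bool} {b : Bool}
    (h : (Fin.snoc v b : Fin (n + 1) → Bool) = fun t : Fin (n + 1) => s t) :
    v = fun t : Fin n => s t := by
  rw [← snoc_truncation, Fin.snoc_inj] at h
  exact h.1

theorem not_exists_truncation_of_le {M : ℕ}
    (hnest : ∀ k, 1 ≤ k → k + 1 ≤ M + 1 → ∀ i : Fin (q (k + 1)),
      ∃ j : Fin (q k), ∃ b : Bool, Sidx (k + 1) i = Fin.snoc (Sidx k j) b)
    {s : ℕ → Bool} {k : ℕ} (hk : 1 ≤ k)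
    (hnot : ¬ ∃ i, Sidx k i = fun t : Fin k => s t) {m : ℕ} (hkm : k ≤ m) :
    m ≤ M + 1 → ¬ ∃ i, Sidx m i = fun t : Fin m => s t := by
  induction m, hkm using Nat.le_induction with
  | base => exact fun _ => hnot
  | succ m hkm ih =>
    rintro hm ⟨i, hi⟩
    obtain ⟨j, b, hjb⟩ := hnest m (hk.trans hkm) hm i
    exact ih (by omega) ⟨j, eq_truncation_of_snoc_eq (hjb.symm.trans hi)⟩

/-- The dangerous part of the partial product is the indicator of the current truncation. -/
theorem mrVec_inr (f : ℝ → ℝ) (N : ℕ) {M : ℕ}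
    (hinj : ∀ k, 1 ≤ k → k ≤ M + 1 → Function.Injective (Sidx k))
    (hnest : ∀ k, 1 ≤ k → k + 1 ≤ M + 1 → ∀ i : Fin (q (k + 1)),
      ∃ j : Fin (q k), ∃ b : Bool, Sidx (k + 1) i = Fin.snoc (Sidx k j) b)
    (s : ℕ → Bool) (m : ℕ) (hm : m ≤ M) (i : Fin (q (m + 1))) :
    mrVec f N q Sidx m (fun t => s t) (Sum.inr i) =
      if Sidx (m + 1) i = fun t : Fin (m + 1) => s t then 1 else 0 := by
  induction m with
  | zero => rfl
  | succ m ih =>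
    simp only [mrVec, Sum.elim_inr, Fin.val_castSucc, Fin.val_last]
    simp_rw [ih (by omega)]
    obtain ⟨j, b, hjb⟩ := hnest (m + 1) (by omega) (by omega) i
    split_ifs with h
    · have hj := eq_truncation_of_snoc_eq (hjb.symm.trans h)
      rw [Finset.sum_eq_single j]
      · rw [if_pos hj, if_pos (by rw [hj, snoc_truncation, h]), one_mul]
      · intro i' _ hne
        rw [if_neg, zero_mul]
        exact fun h' => hne (hinj (m + 1) (by omega) (by omega) (h'.trans hj.symm))
      · simp
    · refine Finset.sum_eq_zero fun i' _ => ?_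
      by_cases h' : Sidx (m + 1) i' = fun t : Fin (m + 1) => s t
      · rw [if_pos h', if_neg (by rwa [h', snoc_truncation]), mul_zero]
      · rw [if_neg h', zero_mul]

theorem sum_mrVec_inr_mul_of_eq (f : ℝ → ℝ) (N : ℕ) {M : ℕ}
    (hinj : ∀ k, 1 ≤ k → k ≤ M + 1 → Function.Injective (Sidx k))
    (hnest : ∀ k, 1 ≤ k → k + 1 ≤ M + 1 → ∀ i : Fin (q (k + 1)),
      ∃ j : Fin (q k), ∃ b : Bool, Sidx (k + 1) i = Fin.snoc (Sidx k j) b)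
    {s : ℕ → Bool} {m : ℕ} (hm : m ≤ M) {i : Fin (q (m + 1))}
    (hi : Sidx (m + 1) i = fun t : Fin (m + 1) => s t) (g : Fin (q (m + 1)) → ℝ) :
    ∑ j, mrVec f N q Sidx m (fun t => s t) (Sum.inr j) * g j = g i := by
  simp_rw [mrVec_inr f N hinj hnest s m hm]
  rw [Finset.sum_eq_single i]
  · rw [if_pos hi, one_mul]
  · intro j _ hne
    rw [if_neg, zero_mul]
    exact fun h' => hne (hinj (m + 1) (by omega) (by omega) (h'.trans hi.symm))
  · simp

theorem sum_mrVec_inr_mul_of_not_exists (f : ℝ → ℝ) (N : ℕ) {M : ℕ}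
    (hinj : ∀ k, 1 ≤ k → k ≤ M + 1 → Function.Injective (Sidx k))
    (hnest : ∀ k, 1 ≤ k → k + 1 ≤ M + 1 → ∀ i : Fin (q (k + 1)),
      ∃ j : Fin (q k), ∃ b : Bool, Sidx (k + 1) i = Fin.snoc (Sidx k j) b)
    {s : ℕ → Bool} {m : ℕ} (hm : m ≤ M)
    (hs : ¬ ∃ i, Sidx (m + 1) i = fun t : Fin (m + 1) => s t) (g : Fin (q (m + 1)) → ℝ) :
    ∑ j, mrVec f N q Sidx m (fun t => s t) (Sum.inr j) * g j = 0 := by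
  refine Finset.sum_eq_zero fun j _ => ?_
  rw [mrVec_inr f N hinj hnest s m hm, if_neg fun h => hs ⟨j, h⟩, zero_mul]

/-- While the truncation stays dangerous, the grid part of the partial product vanishes. -/
theorem mrVec_inl_eq_zero (f : ℝ → ℝ) (N : ℕ) {M : ℕ}
    (hinj : ∀ k, 1 ≤ k → k ≤ M + 1 → Function.Injective (Sidx k))
    (hnest : ∀ k, 1 ≤ k → k + 1 ≤ M + 1 → ∀ i : Fin (q (k + 1)),
      ∃ j : Fin (q k), ∃ b : Bool, Sidx (k + 1) i = Fin.snoc (Sidx k j) b)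
    {s : ℕ → Bool} {k : ℕ}
    (hmin : ∀ l, 1 ≤ l → l < k → ∃ i, Sidx l i = fun t : Fin l => s t)
    (m : ℕ) (hm : m ≤ M) (hmk : m + 1 < k) (β : Fin (N + 1)) :
    mrVec f N q Sidx m (fun t => s t) (Sum.inl β) = 0 := by
  induction m generalizing β with
  | zero => exact if_pos (hmin 1 le_rfl hmk)
  | succ m ih =>
    obtain ⟨i, hi⟩ := hmin (m + 1) (by omega) (by omega)
    simp only [mrVec, Sum.elim_inl, Fin.val_castSucc, Fin.val_last]
    rw [sum_mrVec_inr_mul_of_eq f N hinj hnest (by omega) hi, hi, snoc_truncation,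
      if_pos (hmin (m + 2) (by omega) hmk), add_zero]
    exact Finset.sum_eq_zero fun α _ => by rw [ih (by omega) (by omega), zero_mul]

/-- At the first non-dangerous truncation, the grid part samples `f` on the scaled grid. -/
theorem mrVec_inl_first (f : ℝ → ℝ) (N : ℕ) {M : ℕ}
    (hinj : ∀ k, 1 ≤ k → k ≤ M + 1 → Function.Injective (Sidx k))
    (hnest : ∀ k, 1 ≤ k → k + 1 ≤ M + 1 → ∀ i : Fin (q (k + 1)),
      ∃ j : Fin (q k), ∃ b : Bool, Sidx (k + 1) i = Fin.snoc (Sidx k j) b)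
    {s : ℕ → Bool} (m : ℕ) (hm : m ≤ M)
    (hnot : ¬ ∃ i, Sidx (m + 1) i = fun t : Fin (m + 1) => s t)
    (hmin : ∀ l, 1 ≤ l → l < m + 1 → ∃ i, Sidx l i = fun t : Fin l => s t)
    (β : Fin (N + 1)) :
    mrVec f N q Sidx m (fun t => s t) (Sum.inl β) =
      f ((∑ l ∈ Finset.range (m + 1), bitTerm s l) +
        (2 : ℝ) ^ (-(m + 1 : ℤ)) * chebNode N β) := by
  cases m with
  | zero =>
    refine (if_neg hnot).trans (congrArg f ?_)
    simp [bitTerm]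
    ring
  | succ m =>
    obtain ⟨i, hi⟩ := hmin (m + 1) (by omega) (by omega)
    simp only [mrVec, Sum.elim_inl, Fin.val_castSucc, Fin.val_last]
    rw [sum_mrVec_inr_mul_of_eq f N hinj hnest (by omega) hi, hi, snoc_truncation, if_neg hnot]
    rw [Finset.sum_eq_zero fun α _ => by
      rw [mrVec_inl_eq_zero f N hinj hnest hmin m (by omega) (by omega), zero_mul], zero_add,
      Finset.sum_range_succ, Finset.sum_range]
    have h2 : ((m + 1 : ℕ) : ℤ) + 1 = (m : ℤ) + 2 := by push_cast; ring
    simp only [bitTerm, h2]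

open Finset in
/-- From the first non-dangerous truncation on, the grid part samples the interpolant of `f`. -/
theorem mrVec_inl_of_le (f : ℝ → ℝ) {N : ℕ} (hN : 1 ≤ N) {M : ℕ}
    (hinj : ∀ k, 1 ≤ k → k ≤ M + 1 → Function.Injective (Sidx k))
    (hnest : ∀ k, 1 ≤ k → k + 1 ≤ M + 1 → ∀ i : Fin (q (k + 1)),
      ∃ j : Fin (q k), ∃ b : Bool, Sidx (k + 1) i = Fin.snoc (Sidx k j) b)
    {s : ℕ → Bool} (k : ℕ)
    (hnot : ¬ ∃ i, Sidx (k + 1) i = fun t : Fin (k + 1) => s t)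
    (hmin : ∀ l, 1 ≤ l → l < k + 1 → ∃ i, Sidx l i = fun t : Fin l => s t)
    (m : ℕ) (hkm : k ≤ m) (hm : m ≤ M) (β : Fin (N + 1)) :
    mrVec f N q Sidx m (fun t => s t) (Sum.inl β) =
      ∑ α ∈ range (N + 1),
        f ((∑ l ∈ range (k + 1), bitTerm s l) + (2 : ℝ) ^ (-(k + 1 : ℤ)) * chebNode N α) *
          chebP N α ((2 : ℝ) ^ (k + 1) * ∑ l ∈ Ico (k + 1) (m + 1), bitTerm s l +
            (2 : ℝ) ^ (k + 1) * (2 : ℝ) ^ (-(m + 1 : ℤ)) * chebNode N β) := by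
  induction m, hkm using Nat.le_induction generalizing β with
  | base =>
    have hpow : (2 : ℝ) ^ (k + 1) * (2 : ℝ) ^ (-(k + 1 : ℤ)) = 1 := by
      rw [← zpow_natCast, ← zpow_add₀ two_ne_zero]
      simp
    have hβ : (β : ℕ) ∈ range (N + 1) := mem_range.mpr β.2
    rw [mrVec_inl_first f N hinj hnest k hm hnot hmin β]
    symm
    refine (sum_eq_single (β : ℕ) ?_ ?_).trans ?_
    rotate_left 2
    · rw [hpow, Ico_self, sum_empty, mul_zero, zero_add, one_mul, chebP_chebNode hN hβ hβ,
        if_pos rfl, mul_one]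
    · intro α hα hne
      rw [hpow, Ico_self, sum_empty, mul_zero, zero_add, one_mul, chebP_chebNode hN hα hβ,
        if_neg hne, mul_zero]
    · exact fun h => absurd hβ h
  | succ m hkm ih =>
    have hs := not_exists_truncation_of_le hnest (by omega) hnot
      (show k + 1 ≤ m + 1 by omega) (by omega)
    simp only [mrVec, Sum.elim_inl, Fin.val_castSucc, Fin.val_last]
    rw [sum_mrVec_inr_mul_of_not_exists f N hinj hnest (by omega) hs, add_zero]
    simp_rw [ih (by omega)]
    simp_rw [sum_mul]
    rw [sum_comm]
    refine sum_congr rfl fun α hα => ?_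
    simp_rw [mul_assoc (f _)]
    rw [← mul_sum, ← sum_range (fun β' => chebP N α (_ + _ * chebNode N β') * chebP N β' _),
      sum_chebP_affine_mul_chebP hN hα, sum_Ico_succ_top (show k + 1 ≤ m + 1 by omega)]
    congr 2
    have h2 := two_zpow_neg_add_one ((m : ℤ) + 1)
    simp only [bitTerm, Nat.cast_add, Nat.cast_one, h2]
    ring

end Nested

/-- interpretation of the entries of the multiresolution MPS
`S = A_1 ⋯ A_K` (with `K = M + 2 ≥ 2`). For fixed `σ_{1:K}`, if `k` is the smallest
index with `σ_{1:k} ∉ 𝒮_k`, then for `k ≤ K-1` the entry `S(σ_{1:K})` is given by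
Chebyshev–Lobatto interpolation of `f` on `[x_{≤k}, x_{≤k} + 2^{-k}]` evaluated at
`x_{≤K}`, while for `k = K` it equals the exact value `f(x_{≤K})`. -/
theorem stmt15 (f : ℝ → ℝ) (N M : ℕ) (hN : 1 ≤ N)
    (q : ℕ → ℕ) (hqK : q (M + 2) = 0)
    (Sidx : (k : ℕ) → Fin (q k) → (Fin k → Bool))
    (hinj : ∀ k, 1 ≤ k → k ≤ M + 1 → Function.Injective (Sidx k))
    (hnest : ∀ k, 1 ≤ k → k + 1 ≤ M + 1 → ∀ i : Fin (q (k + 1)),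
      ∃ j : Fin (q k), ∃ b : Bool, Sidx (k + 1) i = Fin.snoc (Sidx k j) b)
    (σ : Fin (M + 2) → Bool) (k : ℕ) (hk1 : 1 ≤ k) (hkK : k ≤ M + 2)
    (hnot : ¬ ∃ i, Sidx k i = fun t : Fin k => σ (Fin.castLE hkK t))
    (hmin : ∀ l, 1 ≤ l → ∀ hlk : l < k,
      ∃ i, Sidx l i = fun t : Fin l => σ (Fin.castLE (hlk.le.trans hkK) t)) :
    (k ≤ M + 1 →
      mrS f N q Sidx M σ =
        ∑ α ∈ Finset.range (N + 1),
          f ((∑ l : Fin (M + 2),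
                if l.val < k then (2 : ℝ) ^ (-(l.val + 1 : ℤ)) * bitVal (σ l) else 0) +
              (2 : ℝ) ^ (-(k : ℤ)) * chebNode N α) *
            chebP N α ((2 : ℝ) ^ (k : ℕ) *
              ∑ l : Fin (M + 2),
                if k ≤ l.val then (2 : ℝ) ^ (-(l.val + 1 : ℤ)) * bitVal (σ l) else 0)) ∧
    (k = M + 2 →
      mrS f N q Sidx M σ =
        f (∑ l : Fin (M + 2), (2 : ℝ) ^ (-(l.val + 1 : ℤ)) * bitVal (σ l))) := by
  obtain ⟨s, rfl⟩ : ∃ s : ℕ → Bool, σ = fun t : Fin (M + 2) => s t :=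
    ⟨fun l => if h : l < M + 2 then σ ⟨l, h⟩ else false, by funext t; simp⟩
  simp only [Fin.val_castLE] at hnot hmin
  have hfinal : mrS f N q Sidx M (fun t => s t) =
      (∑ α : Fin (N + 1), mrVec f N q Sidx M (fun t => s t) (Sum.inl α) *
        chebP N α (bitVal (s (M + 1)) / 2)) +
      ∑ i : Fin (q (M + 1)), mrVec f N q Sidx M (fun t => s t) (Sum.inr i) *
        f ((∑ l : Fin (M + 1), (2 : ℝ) ^ (-(l.val + 1 : ℤ)) * bitVal (Sidx (M + 1) i l)) +
            (2 : ℝ) ^ (-((M : ℤ) + 2)) * bitVal (s (M + 1))) := by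
    simp [mrS, Fintype.sum_sum_type]
  have h2 : ((M + 1 : ℕ) : ℤ) + 1 = (M : ℤ) + 2 := by push_cast; ring
  refine ⟨fun hk => ?_, fun hk => ?_⟩
  · obtain ⟨k, rfl⟩ : ∃ k', k = k' + 1 := ⟨k - 1, by omega⟩
    have hs := not_exists_truncation_of_le hnest hk1 hnot hk le_rfl
    have hlow : (∑ l : Fin (M + 2), if l.val < k + 1 then
        (2 : ℝ) ^ (-(l.val + 1 : ℤ)) * bitVal (s l) else 0) =
        ∑ l ∈ Finset.range (k + 1), bitTerm s l := by
      refine (Finset.sum_range (fun l => if l < k + 1 then bitTerm s l else 0)).symm.trans ?_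
      rw [← Finset.sum_filter]
      congr 1
      ext l
      simp only [Finset.mem_filter, Finset.mem_range]
      omega
    have hhigh : (∑ l : Fin (M + 2), if k + 1 ≤ l.val then
        (2 : ℝ) ^ (-(l.val + 1 : ℤ)) * bitVal (s l) else 0) =
        ∑ l ∈ Finset.Ico (k + 1) (M + 2), bitTerm s l := by
      refine (Finset.sum_range (fun l => if k + 1 ≤ l then bitTerm s l else 0)).symm.trans ?_
      rw [← Finset.sum_filter]
      congr 1
      ext l
      simp only [Finset.mem_filter, Finset.mem_range, Finset.mem_Ico]
      omega
    rw [hlow, hhigh, hfinal, sum_mrVec_inr_mul_of_not_exists f N hinj hnest le_rfl hs, add_zero]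
    simp_rw [mrVec_inl_of_le f hN hinj hnest k hnot hmin M (by omega) le_rfl, Finset.sum_mul]
    rw [Finset.sum_comm]
    refine Finset.sum_congr rfl fun α hα => ?_
    simp_rw [mul_assoc (f _)]
    rw [← Finset.mul_sum,
      ← Finset.sum_range (fun β' => chebP N α (_ + _ * chebNode N β') * chebP N β' _),
      sum_chebP_affine_mul_chebP hN hα, Finset.sum_Ico_succ_top hk]
    have h3 := two_zpow_neg_add_one ((M : ℤ) + 1)
    simp only [bitTerm, Nat.cast_add, Nat.cast_one, h3]
    congr 2
    ring
  · subst hk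
    obtain ⟨i, hi⟩ := hmin (M + 1) (by omega) (by omega)
    rw [hfinal, sum_mrVec_inr_mul_of_eq f N hinj hnest le_rfl hi, hi,
      Finset.sum_eq_zero fun α _ => by
        rw [mrVec_inl_eq_zero f N hinj hnest hmin M le_rfl (by omega), zero_mul],
      zero_add, Fin.sum_univ_castSucc (n := M + 1)]
    simp only [Fin.val_castSucc, Fin.val_last, h2]
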